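/- Let z ≠ 0 be real and, on the open subset of ℝ² where q_1 ≠ 0 and q_2 ≠ 0, consider the diagonal metric determined by the Hamiltonian H = ½ J_+ e^{−z J_-}, namely g_{11}(q_1,q_2) = (2 z q_1²/sinh(z q_1²)) e^{z q_1²} and g_{22}(q_1,q_2) = (2 z q_2²/sinh(z q_2²)) e^{2 z q_1²} e^{z q_2²}. Then its Gaussian curvature is constant and equal to K = −z at every point of this open set. -/

import Mathlib

open Real

noncomputable section

/-- Partial derivative in the first coordinate of a function on ℝ². -/
noncomputable def pd1 (f : ℝ × ℝ → ℝ) (x : ℝ × ℝ) : ℝ :=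
  deriv (fun t => f (t, x.2)) x.1

/-- Partial derivative in the second coordinate of a function on ℝ². -/
noncomputable def pd2 (f : ℝ × ℝ → ℝ) (x : ℝ × ℝ) : ℝ :=
  deriv (fun t => f (x.1, t)) x.2

/-- Gaussian curvature of the diagonal metric `ds² = g₁₁ dq₁² + g₂₂ dq₂²`:
`K = −(1/√(g₁₁g₂₂)) [ ∂₁((1/√g₁₁) ∂₁√g₂₂) + ∂₂((1/√g₂₂) ∂₂√g₁₁) ]`. -/
noncomputable def gaussK (g11 g22 : ℝ × ℝ → ℝ) (x : ℝ × ℝ) : ℝ :=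
  -(1 / Real.sqrt (g11 x * g22 x)) *
    (pd1 (fun y => 1 / Real.sqrt (g11 y) * pd1 (fun w => Real.sqrt (g22 w)) y) x
      + pd2 (fun y => 1 / Real.sqrt (g22 y) * pd2 (fun w => Real.sqrt (g11 w)) y) x)

theorem div_sinh_pos {u : ℝ} (hu : u ≠ 0) : 0 < u / Real.sinh u := by
  rcases hu.lt_or_gt with h | h
  · exact div_pos_of_neg_of_neg h (Real.sinh_neg_iff.2 h)
  · exact div_pos h (Real.sinh_pos_iff.2 h)

theorem metric_factor_pos {z t : ℝ} (hz : z ≠ 0) (ht : t ≠ 0) :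
    0 < 2 * z * t ^ 2 / Real.sinh (z * t ^ 2) * Real.exp (z * t ^ 2) := by
  have h := div_sinh_pos (mul_ne_zero hz (pow_ne_zero 2 ht))
  have e : 2 * z * t ^ 2 / Real.sinh (z * t ^ 2) = 2 * (z * t ^ 2 / Real.sinh (z * t ^ 2)) := by
    ring
  rw [e]
  positivity

theorem hasDerivAt_exp_mul_sq (z t : ℝ) :
    HasDerivAt (fun s => Real.exp (z * s ^ 2)) (Real.exp (z * t ^ 2) * (2 * z * t)) t := by
  convert ((hasDerivAt_pow 2 t).const_mul z).exp using 1
  push_cast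
  ring

theorem sqrt_mul_exp_mul (z t b d : ℝ) :
    Real.sqrt (b * Real.exp (2 * z * t ^ 2) * d) = Real.sqrt (b * d) * Real.exp (z * t ^ 2) := by
  have e : b * Real.exp (2 * z * t ^ 2) * d = b * d * Real.exp (z * t ^ 2) ^ 2 := by
    rw [← Real.exp_nat_mul]
    push_cast
    ring_nf
  rw [e, Real.sqrt_mul' _ (sq_nonneg _), Real.sqrt_sq (Real.exp_pos _).le]

theorem hasDerivAt_inv_sqrt_mul_exp {z t : ℝ} (hz : z ≠ 0) (ht : t ≠ 0) :
    HasDerivAt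
      (fun s => 1 / Real.sqrt (2 * z * s ^ 2 / Real.sinh (z * s ^ 2) * Real.exp (z * s ^ 2))
        * (Real.exp (z * s ^ 2) * (2 * z * s)))
      (z * Real.exp (z * t ^ 2)
        * Real.sqrt (2 * z * t ^ 2 / Real.sinh (z * t ^ 2) * Real.exp (z * t ^ 2))) t := by
  have hG := metric_factor_pos hz ht
  have hS : Real.sinh (z * t ^ 2) ≠ 0 :=
    Real.sinh_ne_zero.2 (mul_ne_zero hz (pow_ne_zero 2 ht))
  have hq := hasDerivAt_pow 2 t
  have hE := hasDerivAt_exp_mul_sq z t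
  have hg := ((hq.const_mul (2 * z)).div (hq.const_mul z).sinh hS).mul hE
  have hr := Real.sqrt_ne_zero'.2 hG
  have h := ((hasDerivAt_const t (1 : ℝ)).div (hg.sqrt hG.ne') hr).mul
    (hE.mul ((hasDerivAt_id t).const_mul (2 * z)))
  refine h.congr_deriv ?_
  simp only [Pi.mul_apply, Pi.div_apply, id]
  have hsq := Real.sq_sqrt hG.le
  have hexp := Real.cosh_add_sinh (z * t ^ 2)
  set r := Real.sqrt (2 * z * t ^ 2 / Real.sinh (z * t ^ 2) * Real.exp (z * t ^ 2))
  set S := Real.sinh (z * t ^ 2)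
  set C := Real.cosh (z * t ^ 2)
  set E := Real.exp (z * t ^ 2)
  have hr2 : r ^ 2 * S = 2 * z * t ^ 2 * E := by
    rw [hsq]
    field_simp
  push_cast
  field_simp
  linear_combination (2 * E * S * (2 * z * t ^ 2 + 1) - E * (r ^ 2 * S + 2 * z * t ^ 2 * E)) * hr2
    + 4 * z ^ 2 * t ^ 4 * E ^ 2 * hexp

/-- the metric determined by `H = ½ J₊ e^{−zJ₋}`, namely
`g₁₁ = (2zq₁²/sinh(zq₁²)) e^{zq₁²}`,
`g₂₂ = (2zq₂²/sinh(zq₂²)) e^{2zq₁²} e^{zq₂²}`, has constant Gaussian curvature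
`K = −z` wherever `q₁ ≠ 0` and `q₂ ≠ 0`. -/
theorem curvature_MS_case_opposite (z : ℝ) (hz : z ≠ 0)
    (x : ℝ × ℝ) (h1 : x.1 ≠ 0) (h2 : x.2 ≠ 0) :
    gaussK
      (fun y => 2 * z * y.1 ^ 2 / Real.sinh (z * y.1 ^ 2) * Real.exp (z * y.1 ^ 2))
      (fun y => 2 * z * y.2 ^ 2 / Real.sinh (z * y.2 ^ 2)
        * Real.exp (2 * z * y.1 ^ 2) * Real.exp (z * y.2 ^ 2))
      x
      = -z := by
  obtain ⟨a, b⟩ := x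
  have ha : a ≠ 0 := h1
  have hb : b ≠ 0 := h2
  have hA := metric_factor_pos hz ha
  have hB := metric_factor_pos hz hb
  have hP := hasDerivAt_inv_sqrt_mul_exp hz ha
  have hD : ∀ t c : ℝ, deriv (fun s => c * Real.exp (z * s ^ 2)) t
      = c * (Real.exp (z * t ^ 2) * (2 * z * t)) := fun t c =>
    ((hasDerivAt_exp_mul_sq z t).const_mul c).deriv
  simp only [gaussK, pd1, pd2, deriv_const, mul_zero, add_zero, sqrt_mul_exp_mul, hD]
  set c := Real.sqrt (2 * z * b ^ 2 / Real.sinh (z * b ^ 2) * Real.exp (z * b ^ 2)) with hcdef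
  have hc : c ≠ 0 := Real.sqrt_ne_zero'.2 hB
  have hr := Real.sqrt_ne_zero'.2 hA
  simp only [mul_left_comm _ c]
  rw [(hP.const_mul c).deriv, Real.sqrt_mul hA.le, sqrt_mul_exp_mul, ← hcdef]
  set r := Real.sqrt (2 * z * a ^ 2 / Real.sinh (z * a ^ 2) * Real.exp (z * a ^ 2))
  have hE := Real.exp_ne_zero (z * a ^ 2)
  field_simp
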